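/- Let m ≥ 2 be an integer, a an integer with 0 ≤ a ≤ m−2, and z = α + iy a complex number with α real and y < 0. Let z̄ = α − iy be its complex conjugate (which lies in the upper half-plane) and define Φ_m^{(a)}(τ) = Σ_{n∈ℤ} n χ_{2m}^{(a)}(n) e^{π i n² τ/(2m)} for Im τ > 0. Then √(m/(8i)) ∫_{z̄}^{i∞} Φ_m^{(a)}(τ) (τ − z)^{−1/2} dτ = m Σ_{n=1}^{∞} χ_{2m}^{(a)}(n) e^{π i n² z/(2m)} erfc( n √(−π y / m) ), where the integral is along the vertical line {α + is : s ≥ −y}, the square root (τ−z)^{−1/2} is the principal branch, and erfc(x) = (2/√π) ∫_x^∞ e^{−t²} dt is the complementary error function. -/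

import Mathlib

open scoped Real BigOperators
open Complex (I)

/-- The odd periodic function `χ_{2m}^{(a)} : ℤ → ℂ` with period `2m`, taking the value
`+1` at `n ≡ m−1−a (mod 2m)`, `−1` at `n ≡ m+1+a (mod 2m)`, and `0` otherwise. -/
def chi (m a : ℕ) (n : ℤ) : ℂ :=
  if (n : ZMod (2 * m)) = ((m - 1 - a : ℕ) : ZMod (2 * m)) then 1
  else if (n : ZMod (2 * m)) = ((m + 1 + a : ℕ) : ZMod (2 * m)) then -1
  else 0

/-- The weight-`3/2` theta series
`Φ_m^{(a)}(τ) = Σ_{n∈ℤ} n χ_{2m}^{(a)}(n) e^{πin²τ/(2m)}` (for `Im τ > 0`). -/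
noncomputable def Phi (m a : ℕ) (τ : ℂ) : ℂ :=
  ∑' n : ℤ, (n : ℂ) * chi m a n * Complex.exp ((π : ℂ) * I * (n : ℂ) ^ 2 * τ / (2 * m))

/-- The complementary error function `erfc(x) = (2/√π) ∫_x^∞ e^{−t²} dt`. -/
noncomputable def erfc (x : ℝ) : ℝ :=
  2 / Real.sqrt π * ∫ t in Set.Ioi x, Real.exp (-t ^ 2)

lemma chi_neg {m a : ℕ} (hm : 2 ≤ m) (ha : a ≤ m - 2) (n : ℤ) : chi m a (-n) = -chi m a n := by
  have hsum : ((m - 1 - a : ℕ) : ZMod (2 * m)) + ((m + 1 + a : ℕ) : ZMod (2 * m)) = 0 := by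
    rw [← Nat.cast_add, show m - 1 - a + (m + 1 + a) = 2 * m by omega, ZMod.natCast_self]
  have hne : ((m - 1 - a : ℕ) : ZMod (2 * m)) ≠ ((m + 1 + a : ℕ) : ZMod (2 * m)) := by
    intro h
    have := (ZMod.natCast_eq_natCast_iff' _ _ _).1 h
    rw [Nat.mod_eq_of_lt (by omega), Nat.mod_eq_of_lt (by omega)] at this
    omega
  unfold chi
  generalize ((m - 1 - a : ℕ) : ZMod (2 * m)) = p at *
  generalize ((m + 1 + a : ℕ) : ZMod (2 * m)) = q at *
  have hq : q = -p := by linear_combination hsum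
  subst hq
  have h1 : ((-n : ℤ) : ZMod (2 * m)) = p ↔ (n : ZMod (2 * m)) = -p := by
    push_cast; exact neg_eq_iff_eq_neg
  have h2 : ((-n : ℤ) : ZMod (2 * m)) = -p ↔ (n : ZMod (2 * m)) = p := by
    push_cast; exact neg_inj
  simp only [h1, h2]
  split_ifs with h3 h4 h5 <;> simp_all

lemma norm_chi_le_one (m a : ℕ) (n : ℤ) : ‖chi m a n‖ ≤ 1 := by
  unfold chi
  split_ifs <;> simp

lemma norm_cexp_vertical (m : ℕ) (N α s : ℝ) :
    ‖Complex.exp ((π : ℂ) * I * (N : ℂ) ^ 2 * ((α : ℂ) + (s : ℂ) * I) / (2 * m))‖ =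
      Real.exp (-(π / (2 * m) * N ^ 2) * s) := by
  rw [Complex.norm_exp]
  congr 1
  have : (π : ℂ) * I * (N : ℂ) ^ 2 * ((α : ℂ) + (s : ℂ) * I) / (2 * m) =
      ((-(π / (2 * m) * N ^ 2) * s : ℝ) : ℂ) + ((π / (2 * m) * N ^ 2 * α : ℝ) : ℂ) * I := by
    push_cast
    linear_combination (π * N ^ 2 * s / (2 * m) : ℂ) * Complex.I_sq
  rw [this, Complex.add_re, Complex.ofReal_re, Complex.re_ofReal_mul, Complex.I_re, mul_zero,
    add_zero]

lemma cexp_vertical (m : ℕ) (N α s : ℝ) :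
    Complex.exp ((π : ℂ) * I * (N : ℂ) ^ 2 * ((α : ℂ) + (s : ℂ) * I) / (2 * m)) =
      Complex.exp ((π : ℂ) * I * (N : ℂ) ^ 2 * α / (2 * m)) *
        (Real.exp (-(π / (2 * m) * N ^ 2) * s) : ℝ) := by
  rw [Complex.ofReal_exp, ← Complex.exp_add]
  congr 1
  push_cast
  linear_combination (π * N ^ 2 * s / (2 * m) : ℂ) * Complex.I_sq

lemma summable_exp_neg_mul_succ_sq {r : ℝ} (hr : 0 < r) (k : ℕ) :
    Summable fun n : ℕ => ((n : ℝ) + 1) ^ k * Real.exp (-(r * ((n : ℝ) + 1) ^ 2)) := by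
  have h := (summable_nat_add_iff 1).2 (Real.summable_pow_mul_exp_neg_nat_mul k hr)
  refine h.of_nonneg_of_le (fun n => by positivity) fun n => ?_
  push_cast
  gcongr
  nlinarith [mul_nonneg hr.le (Nat.cast_nonneg (α := ℝ) n),
    mul_nonneg (mul_nonneg hr.le (Nat.cast_nonneg (α := ℝ) n)) (Nat.cast_nonneg (α := ℝ) n)]

lemma Phi_vertical {m a : ℕ} (hm : 2 ≤ m) (ha : a ≤ m - 2) (α : ℝ) {s : ℝ} (hs : 0 < s) :
    Phi m a ((α : ℂ) + (s : ℂ) * I) = ∑' n : ℕ, 2 * (((n : ℂ) + 1) * chi m a ((n : ℤ) + 1) *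
      Complex.exp ((π : ℂ) * I * ((n : ℂ) + 1) ^ 2 * ((α : ℂ) + (s : ℂ) * I) / (2 * m))) := by
  set f : ℤ → ℂ := fun n => (n : ℂ) * chi m a n *
    Complex.exp ((π : ℂ) * I * (n : ℂ) ^ 2 * ((α : ℂ) + (s : ℂ) * I) / (2 * m)) with hf
  have hm0 : (0 : ℝ) < m := by exact_mod_cast (by omega : 0 < m)
  have hodd : ∀ n, f (-n) = f n := by
    intro n
    simp only [hf, chi_neg hm ha]
    push_cast
    ring_nf
  have hsum : Summable fun n : ℕ => f ((n : ℤ) + 1) := by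
    refine Summable.of_norm_bounded
      (summable_exp_neg_mul_succ_sq (r := π / (2 * m) * s) (by positivity) 1) fun n => ?_
    have h1 := norm_cexp_vertical m ((n : ℝ) + 1) α s
    have h2 : ‖((n : ℂ) + 1)‖ = (n : ℝ) + 1 := by
      exact_mod_cast Complex.norm_of_nonneg (by positivity : (0 : ℝ) ≤ (n : ℝ) + 1)
    push_cast at h1
    simp only [hf]
    push_cast
    rw [norm_mul, norm_mul, h1, h2, pow_one]
    refine mul_le_mul ?_ (le_of_eq ?_) (by positivity) (by positivity)
    · exact mul_le_of_le_one_right (by positivity) (norm_chi_le_one _ _ _)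
    · ring_nf
  have hsum' : Summable fun n : ℕ => f (-((n : ℤ) + 1)) := by simpa only [hodd] using hsum
  have key := tsum_of_add_one_of_neg_add_one (f := f) hsum hsum'
  have h0 : f 0 = 0 := by simp [hf]
  simp only [hodd, h0, add_zero] at key
  rw [tsum_mul_left]
  unfold Phi
  refine key.trans ?_
  rw [two_mul]
  simp [hf]

lemma integrableOn_exp_neg_mul_inv_sqrt_sub {k y : ℝ} (hk : 0 < k) (hy : y < 0) :
    MeasureTheory.IntegrableOn (fun s => Real.exp (-k * s) * (Real.sqrt (s - y))⁻¹)
      (Set.Ici (-y)) := by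
  have h := integrableOn_exp_mul_Ioi (neg_lt_zero.2 hk) (-y)
  rw [← integrableOn_Ici_iff_integrableOn_Ioi] at h
  refine MeasureTheory.Integrable.mono' (h.mul_const (Real.sqrt (-2 * y))⁻¹)
    (by fun_prop) ?_
  filter_upwards [MeasureTheory.ae_restrict_mem measurableSet_Ici] with s hs
  have hs : -y ≤ s := hs
  rw [Real.norm_of_nonneg (by positivity)]
  have : 0 < Real.sqrt (-2 * y) := Real.sqrt_pos.2 (by linarith)
  gcongr
  linarith

lemma integral_exp_neg_mul_inv_sqrt_sub_le {k y : ℝ} (hk : 0 < k) (hy : y < 0) :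
    ∫ s in Set.Ioi (-y), Real.exp (-k * s) * (Real.sqrt (s - y))⁻¹ ≤
      (Real.sqrt (-2 * y))⁻¹ * (Real.exp (k * y) / k) := by
  have h := integrableOn_exp_mul_Ioi (neg_lt_zero.2 hk) (-y)
  have hle := MeasureTheory.setIntegral_mono_on
    ((integrableOn_exp_neg_mul_inv_sqrt_sub hk hy).mono_set Set.Ioi_subset_Ici_self)
    (h.mul_const (Real.sqrt (-2 * y))⁻¹) measurableSet_Ioi (fun s hs => by
      have hs : -y < s := hs
      have : 0 < Real.sqrt (-2 * y) := Real.sqrt_pos.2 (by linarith)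
      gcongr
      linarith)
  refine hle.trans (le_of_eq ?_)
  rw [MeasureTheory.integral_mul_const, integral_exp_mul_Ioi (neg_lt_zero.2 hk), mul_comm]
  congr 1
  rw [neg_mul_neg]
  field_simp

lemma integral_exp_neg_mul_inv_sqrt_sub {k y : ℝ} (hk : 0 < k) (hy : y < 0) :
    ∫ s in Set.Ioi (-y), Real.exp (-k * s) * (Real.sqrt (s - y))⁻¹ =
      Real.exp (-k * y) * Real.sqrt (π / k) * erfc (Real.sqrt (-2 * k * y)) := by
  have hpt : ∀ s ∈ Set.Ici (-y), ((fun t => Real.exp (-t ^ 2)) ∘ fun s => Real.sqrt (k * (s - y))) s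
      * (Real.sqrt k / 2 * (Real.sqrt (s - y))⁻¹) =
      Real.exp (k * y) * (Real.sqrt k / 2) * (Real.exp (-k * s) * (Real.sqrt (s - y))⁻¹) := by
    intro s hs
    have hs : -y ≤ s := hs
    simp only [Function.comp]
    rw [Real.sq_sqrt (mul_nonneg hk.le (by linarith)),
      show -(k * (s - y)) = k * y + -k * s by ring, Real.exp_add]
    ring
  have hsub := MeasureTheory.integral_comp_mul_deriv_Ioi (a := -y)
    (f := fun s => Real.sqrt (k * (s - y)))
    (f' := fun s => Real.sqrt k / 2 * (Real.sqrt (s - y))⁻¹)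
    (g := fun t => Real.exp (-t ^ 2)) (by fun_prop)
    (Real.tendsto_sqrt_atTop.comp
      ((Filter.tendsto_atTop_add_const_right _ (-y) Filter.tendsto_id).const_mul_atTop hk))
    (fun s hs => by
      have hs : -y < s := hs
      have hpos : 0 < s - y := by linarith
      have h1 : HasDerivAt (fun s => k * (s - y)) k s := by
        simpa using ((hasDerivAt_id s).sub_const y).const_mul k
      have h2 := h1.sqrt (mul_pos hk hpos).ne'
      refine h2.hasDerivWithinAt.congr_deriv ?_
      rw [Real.sqrt_mul hk.le]
      have := Real.sqrt_pos.2 hk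
      have := Real.sqrt_pos.2 hpos
      field_simp
      rw [Real.sq_sqrt hk.le])
    (by fun_prop)
    (by simpa using (integrable_exp_neg_mul_sq one_pos).integrableOn)
    (MeasureTheory.IntegrableOn.congr_fun ((integrableOn_exp_neg_mul_inv_sqrt_sub hk hy).const_mul
      (Real.exp (k * y) * (Real.sqrt k / 2))) (fun s hs => (hpt s hs).symm)
      measurableSet_Ici)
  rw [MeasureTheory.setIntegral_congr_fun measurableSet_Ioi
    (fun s hs => hpt s (Set.Ioi_subset_Ici_self hs)), MeasureTheory.integral_const_mul] at hsub
  simp only [show k * (-y - y) = -2 * k * y by ring] at hsub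
  rw [erfc, ← hsub, Real.sqrt_div Real.pi_pos.le, neg_mul, Real.exp_neg]
  have := Real.sqrt_pos.2 hk
  have := Real.sqrt_pos.2 Real.pi_pos
  field_simp

lemma ofReal_mul_cpow {r : ℝ} (hr : 0 < r) {x : ℂ} (hx : x ≠ 0) (w : ℂ) :
    ((r : ℂ) * x) ^ w = (r : ℂ) ^ w * x ^ w := by
  have hr' : (r : ℂ) ≠ 0 := Complex.ofReal_ne_zero.2 hr.ne'
  rw [Complex.cpow_def_of_ne_zero (mul_ne_zero hr' hx), Complex.cpow_def_of_ne_zero hr',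
    Complex.cpow_def_of_ne_zero hx, Complex.log_ofReal_mul hr hx, Complex.ofReal_log hr.le,
    ← Complex.exp_add]
  ring_nf

lemma cpow_neg_half_vertical (α : ℝ) {y s : ℝ} (h : y < s) :
    ((α : ℂ) + (s : ℂ) * I - ((α : ℂ) + (y : ℂ) * I)) ^ (-((1 : ℂ) / 2)) =
      I ^ (-((1 : ℂ) / 2)) * ((Real.sqrt (s - y))⁻¹ : ℝ) := by
  have hpos : 0 < s - y := sub_pos.2 h
  rw [show (α : ℂ) + (s : ℂ) * I - ((α : ℂ) + (y : ℂ) * I) = ((s - y : ℝ) : ℂ) * I by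
    push_cast; ring, ofReal_mul_cpow hpos Complex.I_ne_zero, mul_comm]
  congr 1
  rw [Real.sqrt_eq_rpow, ← Real.rpow_neg hpos.le, Complex.ofReal_cpow hpos.le]
  push_cast
  rfl

lemma cpow_half_mul_I_cpow_neg_half {r : ℝ} (hr : 0 < r) :
    ((r : ℂ) / (8 * I)) ^ ((1 : ℂ) / 2) * (I ^ (-((1 : ℂ) / 2)) * I) = (Real.sqrt (r / 8) : ℝ) := by
  have hr8 : 0 < r / 8 := by positivity
  have hdiv : (r : ℂ) / (8 * I) = ((r / 8 : ℝ) : ℂ) * (-I) := by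
    rw [div_mul_eq_div_div, Complex.div_I]
    push_cast
    ring
  have hphase : (-I) ^ ((1 : ℂ) / 2) * (I ^ (-((1 : ℂ) / 2)) * I) = 1 := by
    rw [Complex.cpow_def_of_ne_zero (neg_ne_zero.2 Complex.I_ne_zero),
      Complex.cpow_def_of_ne_zero Complex.I_ne_zero, Complex.log_neg_I, Complex.log_I, ← mul_assoc,
      ← Complex.exp_add,
      show -((π : ℂ) / 2) * I * (1 / 2) + (π : ℂ) / 2 * I * -(1 / 2) = -(π / 2 * I) by ring,
      Complex.exp_neg, Complex.exp_pi_div_two_mul_I, inv_mul_cancel₀ Complex.I_ne_zero]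
  rw [hdiv, ofReal_mul_cpow hr8 (neg_ne_zero.2 Complex.I_ne_zero), mul_assoc, hphase, mul_one,
    Real.sqrt_eq_rpow, Complex.ofReal_cpow hr8.le]
  push_cast
  rfl

/-- The normalisation constants of the termwise integrals combine to `m`. -/
lemma sqrt_div_eight_mul_sqrt {r N : ℝ} (hr : 0 < r) (hN : 0 < N) :
    Real.sqrt (r / 8) * (2 * N * Real.sqrt (π / (π / (2 * r) * N ^ 2))) = r := by
  have h : π / (π / (2 * r) * N ^ 2) = 2 * r / N ^ 2 := by
    have := Real.pi_pos
    field_simp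
  rw [h, Real.sqrt_div (x := 2 * r) (by positivity), Real.sqrt_sq hN.le,
    show Real.sqrt (r / 8) * (2 * N * (Real.sqrt (2 * r) / N)) =
      2 * (Real.sqrt (r / 8) * Real.sqrt (2 * r)) by field_simp,
    ← Real.sqrt_mul (by positivity), show r / 8 * (2 * r) = (r / 2) ^ 2 by ring,
    Real.sqrt_sq (by positivity)]
  ring

/-- for `m ≥ 2`, `0 ≤ a ≤ m−2` and `z = α + iy` with `y < 0`,
`√(m/(8i)) ∫_{z̄}^{i∞} Φ_m^{(a)}(τ) (τ−z)^{−1/2} dτ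
  = m Σ_{n≥1} χ_{2m}^{(a)}(n) e^{πin²z/(2m)} erfc(n √(−πy/m))`,
the integral being taken along the vertical line `{α + is : s ≥ −y}` (so `τ = α + is`,
`dτ = i ds`), with principal branches of the square roots. -/
theorem stmt15 (m a : ℕ) (hm : 2 ≤ m) (ha : a ≤ m - 2) (α y : ℝ) (hy : y < 0) :
    ((m : ℂ) / (8 * I)) ^ ((1 : ℂ) / 2) *
        ∫ s in Set.Ioi (-y),
          Phi m a ((α : ℂ) + (s : ℂ) * I) *
            (((α : ℂ) + (s : ℂ) * I - ((α : ℂ) + (y : ℂ) * I)) ^ (-((1 : ℂ) / 2))) * I =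
      (m : ℂ) * ∑' n : ℕ,
        chi m a ((n : ℤ) + 1) *
          Complex.exp ((π : ℂ) * I * ((n : ℂ) + 1) ^ 2 * ((α : ℂ) + (y : ℂ) * I) / (2 * m)) *
          (erfc (((n : ℝ) + 1) * Real.sqrt (-π * y / m)) : ℝ) := by
  have hm0 : (0 : ℝ) < m := by exact_mod_cast (by omega : 0 < m)
  set k : ℕ → ℝ := fun n => π / (2 * m) * ((n : ℝ) + 1) ^ 2 with hk
  have hkpos : ∀ n, 0 < k n := fun n => by simp only [hk]; positivity
  set J : ℕ → ℝ → ℝ := fun n s => Real.exp (-k n * s) * (Real.sqrt (s - y))⁻¹ with hJ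
  set C : ℕ → ℂ := fun n => 2 * (((n : ℂ) + 1) * chi m a ((n : ℤ) + 1) *
    Complex.exp ((π : ℂ) * I * ((n : ℂ) + 1) ^ 2 * α / (2 * m))) with hC
  have hCnorm : ∀ n, ‖C n‖ ≤ 2 * ((n : ℝ) + 1) := by
    intro n
    have h1 := norm_cexp_vertical m ((n : ℝ) + 1) α 0
    have h2 : ‖((n : ℂ) + 1)‖ = (n : ℝ) + 1 := by
      exact_mod_cast Complex.norm_of_nonneg (by positivity : (0 : ℝ) ≤ (n : ℝ) + 1)
    simp only [Complex.ofReal_zero, zero_mul, add_zero, mul_zero, Real.exp_zero] at h1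
    push_cast at h1
    simp only [hC]
    rw [norm_mul, norm_mul, norm_mul, h1, h2, mul_one, Complex.norm_ofNat]
    gcongr
    exact mul_le_of_le_one_right (by positivity) (norm_chi_le_one _ _ _)
  have hJint : ∀ n, MeasureTheory.IntegrableOn (J n) (Set.Ioi (-y)) := fun n =>
    (integrableOn_exp_neg_mul_inv_sqrt_sub (hkpos n) hy).mono_set Set.Ioi_subset_Ici_self
  have hFint : ∀ n, MeasureTheory.IntegrableOn (fun s => C n * (J n s : ℂ)) (Set.Ioi (-y)) :=
    fun n => (hJint n).ofReal.const_mul _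
  have hsum : Summable fun n => ∫ s in Set.Ioi (-y), ‖C n * (J n s : ℂ)‖ := by
    have hb := (summable_exp_neg_mul_succ_sq (r := π / (2 * m) * -y)
      (mul_pos (by positivity) (by linarith)) 0).mul_left
      ((Real.sqrt (-2 * y))⁻¹ * (2 / (π / (2 * m))))
    refine hb.of_nonneg_of_le (fun n => by positivity) fun n => ?_
    have h1 : ∀ s, ‖C n * (J n s : ℂ)‖ = ‖C n‖ * J n s := fun s => by
      rw [norm_mul, Complex.norm_of_nonneg (by simp only [hJ]; positivity)]
    simp only [h1]
    rw [MeasureTheory.integral_const_mul]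
    calc ‖C n‖ * ∫ s in Set.Ioi (-y), J n s
        ≤ 2 * ((n : ℝ) + 1) * ((Real.sqrt (-2 * y))⁻¹ * (Real.exp (k n * y) / k n)) := by
          refine mul_le_mul (hCnorm n) (integral_exp_neg_mul_inv_sqrt_sub_le (hkpos n) hy)
            (MeasureTheory.integral_nonneg fun s => ?_) (by positivity)
          simp only [hJ, Pi.zero_apply]
          positivity
      _ = (Real.sqrt (-2 * y))⁻¹ * (2 / (π / (2 * m))) *
            (((n : ℝ) + 1)⁻¹ * Real.exp (-(π / (2 * m) * -y * ((n : ℝ) + 1) ^ 2))) := by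
          rw [show k n * y = -(π / (2 * m) * -y * ((n : ℝ) + 1) ^ 2) by simp only [hk]; ring]
          simp only [hk]
          field_simp
      _ ≤ _ := by
          rw [pow_zero]
          gcongr
          exact inv_le_one_of_one_le₀ (by linarith [Nat.cast_nonneg (α := ℝ) n])
  have hswap := MeasureTheory.hasSum_integral_of_summable_integral_norm hFint hsum
  have hintegrand : ∀ s ∈ Set.Ioi (-y), Phi m a ((α : ℂ) + (s : ℂ) * I) *
      (((α : ℂ) + (s : ℂ) * I - ((α : ℂ) + (y : ℂ) * I)) ^ (-((1 : ℂ) / 2))) * I =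
      (I ^ (-((1 : ℂ) / 2)) * I) * ∑' n, C n * (J n s : ℂ) := by
    intro s hs
    have hs : -y < s := hs
    rw [Phi_vertical hm ha α (by linarith), cpow_neg_half_vertical α (by linarith),
      ← tsum_mul_left, ← tsum_mul_right, ← tsum_mul_right]
    refine tsum_congr fun n => ?_
    have h1 := cexp_vertical m ((n : ℝ) + 1) α s
    push_cast at h1
    rw [h1]
    simp only [hC, hJ, hk]
    push_cast
    ring
  rw [MeasureTheory.setIntegral_congr_fun measurableSet_Ioi hintegrand,
    MeasureTheory.integral_const_mul, ← mul_assoc]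
  have hconst := cpow_half_mul_I_cpow_neg_half hm0
  rw [Complex.ofReal_natCast] at hconst
  rw [hconst, ← hswap.tsum_eq, ← tsum_mul_left, ← tsum_mul_left]
  refine tsum_congr fun n => ?_
  have hint : ∫ s in Set.Ioi (-y), C n * (J n s : ℂ) =
      C n * ((∫ s in Set.Ioi (-y), J n s : ℝ) : ℂ) := by
    rw [MeasureTheory.integral_const_mul, integral_complex_ofReal]
  have hN : 0 < (n : ℝ) + 1 := by positivity
  have harg : Real.sqrt (-2 * k n * y) = ((n : ℝ) + 1) * Real.sqrt (-π * y / m) := by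
    rw [show -2 * k n * y = ((n : ℝ) + 1) ^ 2 * (-π * y / m) by simp only [hk]; field_simp,
      Real.sqrt_mul (by positivity), Real.sqrt_sq hN.le]
  have h1 := cexp_vertical m ((n : ℝ) + 1) α y
  push_cast at h1
  have h2 := congrArg (fun x : ℝ => (x : ℂ)) (sqrt_div_eight_mul_sqrt hm0 hN)
  push_cast at h2
  rw [hint]
  simp only [hJ]
  rw [integral_exp_neg_mul_inv_sqrt_sub (hkpos n) hy, harg, h1]
  simp only [hC, hk]
  push_cast
  rw [← h2]
  ring
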